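/- arXiv:2406.14931 — 2 statements merged into one kernel-verified Lean document; each statement's English description precedes it below -/
import Mathlib

section
/- Let d₀ > 0, let M and N be positive integers with N ≥ 2, let α ≥ 1 be an integer, let r₀ > 0 and θ₀ ∈ (−1, 1), and suppose (r, θ) with r > 0 and θ ∈ [−1, 1] lies on the inner abnormal ring, i.e., (1−θ²)/r = α/(M²d₀) + (1−θ₀²)/r₀. Then r < M²d₀. Consequently, if such a point lies in the Fresnel region, i.e., r ≥ 1.2(N−1)d₀, then M > √(1.2(N−1)). -/
/-- inner-ring part of Proposition 2: if `(r, θ)` lies on an inner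
abnormal ring, i.e., `(1−θ²)/r = α/(M²d₀) + (1−θ₀²)/r₀` with integer `α ≥ 1`, then
`r < M²d₀`; consequently, if such a point lies in the Fresnel region `r ≥ 1.2(N−1)d₀`,
then `M > √(1.2(N−1))`. -/
theorem inner_abnormal_ring_condition (d₀ : ℝ) (hd₀ : 0 < d₀)
    (M N : ℕ) (hM : 0 < M) (hN : 2 ≤ N) (α : ℤ) (hα : 1 ≤ α)
    (r₀ θ₀ : ℝ) (hr₀ : 0 < r₀) (hθ₀ : θ₀ ∈ Set.Ioo (-1 : ℝ) 1)
    (r θ : ℝ) (hr : 0 < r) (hθ : θ ∈ Set.Icc (-1 : ℝ) 1)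
    (hring : (1 - θ ^ 2) / r = (α : ℝ) / ((M : ℝ) ^ 2 * d₀) + (1 - θ₀ ^ 2) / r₀) :
    r < (M : ℝ) ^ 2 * d₀
    ∧ (r ≥ 1.2 * ((N : ℝ) - 1) * d₀ → (M : ℝ) > Real.sqrt (1.2 * ((N : ℝ) - 1))) := by
  have hM' : (0 : ℝ) < M := by exact_mod_cast hM
  have hα' : (1 : ℝ) ≤ α := by exact_mod_cast hα
  have hD : 0 < (M : ℝ) ^ 2 * d₀ := by positivity
  have hθ₀_pos : 0 < (1 - θ₀ ^ 2) / r₀ :=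
    div_pos (by nlinarith [hθ₀.1, hθ₀.2]) hr₀
  have hlt : r < (M : ℝ) ^ 2 * d₀ := by
    refine (one_div_lt_one_div hD hr).1 ?_
    calc 1 / ((M : ℝ) ^ 2 * d₀) ≤ (α : ℝ) / ((M : ℝ) ^ 2 * d₀) := by gcongr
      _ < (1 - θ ^ 2) / r := by rw [hring]; exact lt_add_of_pos_right _ hθ₀_pos
      _ ≤ 1 / r := by gcongr; exact sub_le_self _ (sq_nonneg θ)
  refine ⟨hlt, fun hF => (Real.sqrt_lt' hM').2 ?_⟩
  exact lt_of_mul_lt_mul_right (hF.trans_lt hlt) hd₀.le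
end

section
/- Let d₀ > 0, let M and N be positive integers with N ≥ 2, let θ₀ ∈ (−1, 1), and let r₀ ≥ 1.2(N−1)d₀. If an outer abnormal ring exists, i.e., (1−θ₀²)/r₀ − 1/(M²d₀) > 0, then M² > r₀/d₀ ≥ 1.2(N−1), and hence M > √(1.2(N−1)). -/
/-- outer-ring part of Proposition 2: with `r₀ ≥ 1.2(N−1)d₀` and
`θ₀ ∈ (−1,1)`, if an outer abnormal ring exists, i.e.,
`(1−θ₀²)/r₀ − 1/(M²d₀) > 0`, then `M² > r₀/d₀ ≥ 1.2(N−1)`, hence `M > √(1.2(N−1))`. -/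
theorem outer_abnormal_ring_condition (d₀ : ℝ) (hd₀ : 0 < d₀)
    (M N : ℕ) (hM : 0 < M) (hN : 2 ≤ N)
    (θ₀ : ℝ) (hθ₀ : θ₀ ∈ Set.Ioo (-1 : ℝ) 1)
    (r₀ : ℝ) (hr₀ : r₀ ≥ 1.2 * ((N : ℝ) - 1) * d₀)
    (houter : (1 - θ₀ ^ 2) / r₀ - 1 / ((M : ℝ) ^ 2 * d₀) > 0) :
    (M : ℝ) ^ 2 > r₀ / d₀
    ∧ r₀ / d₀ ≥ 1.2 * ((N : ℝ) - 1)
    ∧ (M : ℝ) > Real.sqrt (1.2 * ((N : ℝ) - 1)) := by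
  have hN' : (2 : ℝ) ≤ N := by exact_mod_cast hN
  have hM' : (0 : ℝ) < M := by exact_mod_cast hM
  have hr : 0 < r₀ := lt_of_lt_of_le (mul_pos (by linarith) hd₀) hr₀
  have hθ : (1 - θ₀ ^ 2) / r₀ ≤ 1 / r₀ := by
    gcongr
    linarith [sq_nonneg θ₀]
  have hlt : r₀ < (M : ℝ) ^ 2 * d₀ :=
    (one_div_lt_one_div (by positivity) hr).mp (by linarith)
  have hsq : r₀ / d₀ < (M : ℝ) ^ 2 := (div_lt_iff₀ hd₀).mpr hlt
  have hge : 1.2 * ((N : ℝ) - 1) ≤ r₀ / d₀ := (le_div_iff₀ hd₀).mpr hr₀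
  exact ⟨hsq, hge, (Real.sqrt_lt' hM').mpr (hge.trans_lt hsq)⟩
end
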